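/- Let i ∈ ℕ, let w ∈ {⊥,0,1}^i, and let s ∈ ℕ with s ≤ i. There exists an s-balanced fork F ⊢ w if and only if Margin_s(w) ≥ 0. -/

import Mathlib

/-- The alphabet `{⊥, 0, 1}`: `none` is `⊥` (empty slot), `some false` is `0`
(special honest slot), `some true` is `1` (adversarial slot). -/
abbrev Trit : Type := Option Bool

/-- Depth of a vertex in a rooted tree given by a parent function, computed with
fuel (fuel `v` suffices since parents have smaller indices). -/
def depthAux (parent : ℕ → ℕ) : ℕ → ℕ → ℕ
  | 0, _ => 0
  | fuel + 1, v => if v = 0 then 0 else depthAux parent fuel (parent v) + 1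

/-- Depth of vertex `v` (number of edges from the root `0`). -/
def treeDepth (parent : ℕ → ℕ) (v : ℕ) : ℕ := depthAux parent v v

/-- A fork `F ⊢ w` with respect to a characteristic string `w ∈ {⊥,0,1}^i`
(positions `1, …, i`).  The vertices are `0, 1, …, m - 1`; vertex `0` is the root,
every other vertex has a parent of smaller index (edges directed away from the
root).  `label` is the labeling `ℓ`: the root has label `0`, every other vertex is
labeled by an index `j ∈ {1, …, i}` with `w[j] ≠ ⊥`; labels strictly increase along
directed paths; every index `j` with `w[j] = 0` is the label of exactly one vertex;
and the depths of the vertices with such labels increase strictly with the label. -/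
structure Fork (i : ℕ) (w : ℕ → Trit) : Type where
  m : ℕ
  m_pos : 0 < m
  parent : ℕ → ℕ
  label : ℕ → ℕ
  parent_root : parent 0 = 0
  parent_lt : ∀ v, 0 < v → v < m → parent v < v
  label_root : label 0 = 0
  label_valid : ∀ v, 0 < v → v < m → 1 ≤ label v ∧ label v ≤ i ∧ w (label v) ≠ none
  label_lt : ∀ v, 0 < v → v < m → label (parent v) < label v
  honest_unique : ∀ j, 1 ≤ j → j ≤ i → w j = some false →
    ∃! v, 0 < v ∧ v < m ∧ label v = j
  honest_depth_mono : ∀ v₁ v₂, 0 < v₁ → v₁ < m → 0 < v₂ → v₂ < m →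
    w (label v₁) = some false → w (label v₂) = some false →
    label v₁ < label v₂ → treeDepth parent v₁ < treeDepth parent v₂

namespace Fork

variable {i : ℕ} {w : ℕ → Trit}

/-- Depth of a vertex of the fork. A tine is a directed path from the root, so
tines are identified with their terminal vertices; the length of the tine ending at
`v` is `F.depth v`. -/
def depth (F : Fork i w) (v : ℕ) : ℕ := treeDepth F.parent v

/-- `u` is an ancestor of `v` (or `u = v`), i.e. `u` lies on the tine ending at `v`. -/
def Ancestor (F : Fork i w) (u v : ℕ) : Prop := ∃ k : ℕ, F.parent^[k] v = u

/-- The tines ending at `v₁` and `v₂` are `s`-disjoint (`t₁ ≁ₛ t₂`): they share no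
vertex whose label is `≥ s`. -/
def SDisjoint (F : Fork i w) (s v₁ v₂ : ℕ) : Prop :=
  ∀ u, F.Ancestor u v₁ → F.Ancestor u v₂ → F.label u < s

/-- `v` is a leaf of the fork. -/
def IsLeaf (F : Fork i w) (v : ℕ) : Prop := ∀ u, 0 < u → u < F.m → F.parent u ≠ v

/-- The fork is closed: every leaf has a label `j` with `w[j] = 0`. -/
def Closed (F : Fork i w) : Prop :=
  ∀ v, 0 < v → v < F.m → F.IsLeaf v → w (F.label v) = some false

/-- The length of the longest tine of the fork. -/
noncomputable def maxDepth (F : Fork i w) : ℕ :=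
  sSup {d : ℕ | ∃ v, v < F.m ∧ d = F.depth v}

/-- `reserve(t)` for the tine `t` ending at `v`: the number of indices `j > ℓ(t)`
with `w[j] = 1`. -/
def reserve (F : Fork i w) (v : ℕ) : ℕ :=
  ((Finset.Icc 1 i).filter fun j => F.label v < j ∧ w j = some true).card

/-- `reach(t) = reserve(t) - gap(t)` for the tine `t` ending at `v`, where
`gap(t)` is the length of the longest tine minus `length(t)`. -/
noncomputable def reach (F : Fork i w) (v : ℕ) : ℤ :=
  (F.reserve v : ℤ) - ((F.maxDepth : ℤ) - (F.depth v : ℤ))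

/-- `Reach(F, w)`: the largest reach attained by any tine of `F`. -/
noncomputable def reachFork (F : Fork i w) : ℤ :=
  sSup {z : ℤ | ∃ v, v < F.m ∧ z = F.reach v}

/-- `Margin_s(F, w)`: the maximum over pairs of `s`-disjoint tines `t₁ ≁ₛ t₂` of
`min{reach(t₁), reach(t₂)}`. -/
noncomputable def marginFork (F : Fork i w) (s : ℕ) : ℤ :=
  sSup {z : ℤ | ∃ v₁ v₂, v₁ < F.m ∧ v₂ < F.m ∧ F.SDisjoint s v₁ v₂ ∧
    z = min (F.reach v₁) (F.reach v₂)}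

/-- The tine ending at `v` is `l`-viable: for every index `j ≤ l` with `w[j] = 0`,
the depth of the (unique) vertex labeled `j` is at most the length of the tine.
A tine is viable iff it is `i`-viable. -/
def Viable (F : Fork i w) (l v : ℕ) : Prop :=
  ∀ j, 1 ≤ j → j ≤ l → w j = some false →
    ∀ u, 0 < u → u < F.m → F.label u = j → F.depth u ≤ F.depth v

/-- The fork is `(s, l)`-balanced: it contains two `l`-viable tines that are
`s`-disjoint.  It is `s`-balanced iff it is `(s, i)`-balanced. -/
def Balanced (F : Fork i w) (s l : ℕ) : Prop :=
  ∃ v₁ v₂, v₁ < F.m ∧ v₂ < F.m ∧ F.Viable l v₁ ∧ F.Viable l v₂ ∧ F.SDisjoint s v₁ v₂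

/-- The length of the longest tine of the closure `F̄` of `F` (the closure is
obtained by trimming all trailing adversarial vertices, so the length of its
longest tine is the maximum depth of an honest vertex or of the root). -/
noncomputable def closureMaxDepth (F : Fork i w) : ℕ :=
  sSup {d : ℕ | ∃ v, v < F.m ∧ (v = 0 ∨ w (F.label v) = some false) ∧ d = F.depth v}

end Fork

/-- `Reach(w)`: the maximum of `Reach(F, w)` over all closed forks `F ⊢ w`. -/
noncomputable def ReachStr (i : ℕ) (w : ℕ → Trit) : ℤ :=
  sSup {z : ℤ | ∃ F : Fork i w, F.Closed ∧ z = F.reachFork}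

/-- `Margin_s(w)`: the maximum of `Margin_s(F, w)` over all closed forks `F ⊢ w`. -/
noncomputable def MarginStr (i : ℕ) (w : ℕ → Trit) (s : ℕ) : ℤ :=
  sSup {z : ℤ | ∃ F : Fork i w, F.Closed ∧ z = F.marginFork s}

/-- `O_l(w)`: the string obtained from `w` by replacing every symbol `0` at a
position `> l` by `⊥`. -/
def Ol (l : ℕ) (w : ℕ → Trit) : ℕ → Trit :=
  fun j => if l < j ∧ w j = some false then none else w j

theorem depthAux_eq_of_le {p q : ℕ → ℕ} {m : ℕ} (hp : ∀ u, 0 < u → u < m → p u < u)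
    (hpq : ∀ u, u < m → p u = q u) :
    ∀ f g v, v < m → v ≤ f → v ≤ g → depthAux p f v = depthAux q g v := by
  intro f
  induction f with
  | zero =>
    intro g v _ hf _
    obtain rfl : v = 0 := by omega
    cases g <;> simp [depthAux]
  | succ f ih =>
    intro g v hv hf hg
    rcases Nat.eq_zero_or_pos v with rfl | h0
    · cases g <;> simp [depthAux]
    · obtain ⟨g, rfl⟩ : ∃ g', g = g' + 1 := ⟨g - 1, by omega⟩
      have := hp v h0 hv
      simp only [depthAux, h0.ne', if_false]
      rw [← hpq v hv, ih g (p v) (by omega) (by omega) (by omega)]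

namespace Fork

variable {i : ℕ} {w : ℕ → Trit}

theorem depth_root (F : Fork i w) : F.depth 0 = 0 := rfl

theorem depth_eq_succ (F : Fork i w) {v : ℕ} (h0 : 0 < v) (hv : v < F.m) :
    F.depth v = F.depth (F.parent v) + 1 := by
  have := F.parent_lt v h0 hv
  obtain ⟨n, rfl⟩ : ∃ n, v = n + 1 := ⟨v - 1, by omega⟩
  simp only [depth, treeDepth, depthAux, h0.ne', if_false]
  rw [depthAux_eq_of_le F.parent_lt (fun _ _ => rfl) n _ _ (by omega) (by omega) le_rfl]

theorem parent_le (F : Fork i w) {v : ℕ} (hv : v < F.m) : F.parent v ≤ v := by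
  rcases Nat.eq_zero_or_pos v with rfl | h0
  · exact F.parent_root.le
  · exact (F.parent_lt v h0 hv).le

theorem Ancestor.refl (F : Fork i w) (v : ℕ) : F.Ancestor v v := ⟨0, rfl⟩

theorem Ancestor.trans {F : Fork i w} {a b c : ℕ} (h : F.Ancestor a b) (h' : F.Ancestor b c) :
    F.Ancestor a c := by
  obtain ⟨k, rfl⟩ := h
  obtain ⟨l, rfl⟩ := h'
  exact ⟨k + l, Function.iterate_add_apply _ _ _ _⟩

theorem ancestor_parent (F : Fork i w) (v : ℕ) : F.Ancestor (F.parent v) v := ⟨1, rfl⟩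

theorem Ancestor.le {F : Fork i w} {a b : ℕ} (h : F.Ancestor a b) (hb : b < F.m) : a ≤ b := by
  obtain ⟨k, rfl⟩ := h
  induction k with
  | zero => exact le_rfl
  | succ k ih =>
    rw [Function.iterate_succ_apply']
    exact (F.parent_le (ih.trans_lt hb)).trans ih

theorem Ancestor.depth_le {F : Fork i w} {a b : ℕ} (h : F.Ancestor a b) (hb : b < F.m) :
    F.depth a ≤ F.depth b := by
  obtain ⟨k, rfl⟩ := h
  induction k with
  | zero => exact le_rfl
  | succ k ih =>
    rw [Function.iterate_succ_apply']
    have hk : F.parent^[k] b < F.m := (Ancestor.le ⟨k, rfl⟩ hb).trans_lt hb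
    rcases Nat.eq_zero_or_pos (F.parent^[k] b) with h0 | h0
    · rw [h0, F.parent_root, depth_root]
      exact Nat.zero_le _
    · have := F.depth_eq_succ h0 hk
      omega

theorem sDisjoint_root (F : Fork i w) {s : ℕ} (hs : 1 ≤ s) : F.SDisjoint s 0 0 := by
  intro u hu _
  obtain rfl : u = 0 := Nat.le_zero.1 (hu.le F.m_pos)
  rw [F.label_root]
  omega

theorem depth_le_maxDepth (F : Fork i w) {v : ℕ} (hv : v < F.m) : F.depth v ≤ F.maxDepth := by
  refine le_csSup ?_ ⟨v, hv, rfl⟩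
  refine Set.Finite.bddAbove (((Set.finite_Iio F.m).image F.depth).subset ?_)
  rintro _ ⟨u, hu, rfl⟩
  exact ⟨u, hu, rfl⟩

theorem maxDepth_le (F : Fork i w) {D : ℕ} (h : ∀ v, v < F.m → F.depth v ≤ D) :
    F.maxDepth ≤ D := by
  refine csSup_le ⟨_, 0, F.m_pos, rfl⟩ ?_
  rintro _ ⟨u, hu, rfl⟩
  exact h u hu

theorem reserve_le (F : Fork i w) (v : ℕ) : F.reserve v ≤ i :=
  (Finset.card_filter_le _ _).trans (by simp)

theorem reach_le (F : Fork i w) {v : ℕ} (hv : v < F.m) : F.reach v ≤ i := by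
  have := F.reserve_le v
  have := F.depth_le_maxDepth hv
  unfold reach
  omega

theorem bddAbove_margin (F : Fork i w) (s : ℕ) :
    (i : ℤ) ∈ upperBounds {z : ℤ | ∃ v₁ v₂, v₁ < F.m ∧ v₂ < F.m ∧ F.SDisjoint s v₁ v₂ ∧
      z = min (F.reach v₁) (F.reach v₂)} := by
  rintro _ ⟨v₁, v₂, h₁, -, -, rfl⟩
  exact (min_le_left _ _).trans (F.reach_le h₁)

theorem marginFork_nonneg_iff (F : Fork i w) {s : ℕ} (hs : 1 ≤ s) :
    0 ≤ F.marginFork s ↔ ∃ v₁ v₂, v₁ < F.m ∧ v₂ < F.m ∧ F.SDisjoint s v₁ v₂ ∧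
      0 ≤ F.reach v₁ ∧ 0 ≤ F.reach v₂ := by
  constructor
  · intro h
    obtain ⟨v₁, v₂, h₁, h₂, hd, hz⟩ : F.marginFork s ∈ {z : ℤ | ∃ v₁ v₂, v₁ < F.m ∧ v₂ < F.m ∧
        F.SDisjoint s v₁ v₂ ∧ z = min (F.reach v₁) (F.reach v₂)} :=
      Int.csSup_mem ⟨_, 0, 0, F.m_pos, F.m_pos, F.sDisjoint_root hs, rfl⟩
        ⟨_, F.bddAbove_margin s⟩
    rw [hz] at h
    exact ⟨v₁, v₂, h₁, h₂, hd, le_min_iff.1 h⟩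
  · rintro ⟨v₁, v₂, h₁, h₂, hd, hr⟩
    exact (le_min_iff.2 hr).trans (le_csSup ⟨_, F.bddAbove_margin s⟩ ⟨v₁, v₂, h₁, h₂, hd, rfl⟩)

theorem marginFork_le (F : Fork i w) {s : ℕ} (hs : 1 ≤ s) : F.marginFork s ≤ i :=
  csSup_le ⟨_, 0, 0, F.m_pos, F.m_pos, F.sDisjoint_root hs, rfl⟩ (F.bddAbove_margin s)

/-! ### Adding an adversarial leaf -/

/-- The fork obtained from `F` by attaching to the vertex `v` a new leaf with adversarial
label `l`. -/
def addLeaf (F : Fork i w) (v l : ℕ) (hv : v < F.m) (hl : F.label v < l) (hli : l ≤ i)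
    (hw : w l = some true) : Fork i w where
  m := F.m + 1
  m_pos := Nat.succ_pos _
  parent := Function.update F.parent F.m v
  label := Function.update F.label F.m l
  parent_root := by rw [Function.update_of_ne F.m_pos.ne, F.parent_root]
  parent_lt u h0 hu := by
    rcases Nat.lt_succ_iff_lt_or_eq.1 hu with h | rfl
    · rw [Function.update_of_ne h.ne]
      exact F.parent_lt u h0 h
    · rwa [Function.update_self]
  label_root := by rw [Function.update_of_ne F.m_pos.ne, F.label_root]
  label_valid u h0 hu := by
    rcases Nat.lt_succ_iff_lt_or_eq.1 hu with h | rfl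
    · rw [Function.update_of_ne h.ne]
      exact F.label_valid u h0 h
    · rw [Function.update_self, hw]
      exact ⟨by omega, hli, by simp⟩
  label_lt u h0 hu := by
    rcases Nat.lt_succ_iff_lt_or_eq.1 hu with h | rfl
    · rw [Function.update_of_ne h.ne, Function.update_of_ne h.ne,
        Function.update_of_ne ((F.parent_lt u h0 h).trans h).ne]
      exact F.label_lt u h0 h
    · rwa [Function.update_self, Function.update_self, Function.update_of_ne hv.ne]
  honest_unique j h1 hj hwj := by
    obtain ⟨u, ⟨h0, hu, rfl⟩, huniq⟩ := F.honest_unique j h1 hj hwj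
    refine ⟨u, ⟨h0, hu.trans (Nat.lt_succ_self _), Function.update_of_ne hu.ne _ _⟩, ?_⟩
    rintro x ⟨hx0, hx, hxl⟩
    rcases Nat.lt_succ_iff_lt_or_eq.1 hx with h | rfl
    · rw [Function.update_of_ne h.ne] at hxl
      exact huniq x ⟨hx0, h, hxl⟩
    · rw [Function.update_self] at hxl
      rw [← hxl, hw] at hwj
      simp at hwj
  honest_depth_mono v₁ v₂ h₁ hv₁ h₂ hv₂ hw₁ hw₂ hlt := by
    have key : ∀ x, x < F.m + 1 → w (Function.update F.label F.m l x) = some false →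
        x < F.m := by
      intro x hx hwx
      rcases Nat.lt_succ_iff_lt_or_eq.1 hx with h | rfl
      · exact h
      · rw [Function.update_self, hw] at hwx
        simp at hwx
    have k₁ := key v₁ hv₁ hw₁
    have k₂ := key v₂ hv₂ hw₂
    rw [Function.update_of_ne k₁.ne] at hw₁ hlt
    rw [Function.update_of_ne k₂.ne] at hw₂ hlt
    have heq : ∀ x, x < F.m → treeDepth (Function.update F.parent F.m v) x
        = treeDepth F.parent x := fun x hx =>
      (depthAux_eq_of_le F.parent_lt
        (fun u hu => (Function.update_of_ne hu.ne _ _).symm) x x x hx le_rfl le_rfl).symm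
    rw [heq v₁ k₁, heq v₂ k₂]
    exact F.honest_depth_mono v₁ v₂ h₁ k₁ h₂ k₂ hw₁ hw₂ hlt

section AddLeaf

variable (F : Fork i w) {v l : ℕ} (hv : v < F.m) (hl : F.label v < l) (hli : l ≤ i)
  (hw : w l = some true)

theorem addLeaf_label {u : ℕ} (hu : u < F.m) :
    (F.addLeaf v l hv hl hli hw).label u = F.label u := Function.update_of_ne hu.ne _ _

theorem addLeaf_label_new : (F.addLeaf v l hv hl hli hw).label F.m = l :=
  Function.update_self _ _ _

theorem addLeaf_parent {u : ℕ} (hu : u < F.m) :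
    (F.addLeaf v l hv hl hli hw).parent u = F.parent u := Function.update_of_ne hu.ne _ _

theorem addLeaf_parent_new : (F.addLeaf v l hv hl hli hw).parent F.m = v :=
  Function.update_self _ _ _

theorem addLeaf_depth {u : ℕ} (hu : u < F.m) :
    (F.addLeaf v l hv hl hli hw).depth u = F.depth u :=
  (depthAux_eq_of_le F.parent_lt (fun _ hx => (F.addLeaf_parent hv hl hli hw hx).symm)
    u u u hu le_rfl le_rfl).symm

theorem addLeaf_depth_new : (F.addLeaf v l hv hl hli hw).depth F.m = F.depth v + 1 := by
  rw [depth_eq_succ _ F.m_pos (Nat.lt_succ_self F.m), addLeaf_parent_new, F.addLeaf_depth _ _ _ _ hv]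

theorem addLeaf_iterate_parent {u : ℕ} (hu : u < F.m) (k : ℕ) :
    (F.addLeaf v l hv hl hli hw).parent^[k] u = F.parent^[k] u := by
  induction k with
  | zero => rfl
  | succ k ih =>
    rw [Function.iterate_succ_apply', Function.iterate_succ_apply', ih]
    exact F.addLeaf_parent hv hl hli hw ((Ancestor.le ⟨k, rfl⟩ hu).trans_lt hu)

theorem addLeaf_ancestor {a u : ℕ} (hu : u < F.m) :
    (F.addLeaf v l hv hl hli hw).Ancestor a u ↔ F.Ancestor a u := by
  simp only [Ancestor, F.addLeaf_iterate_parent hv hl hli hw hu]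

theorem addLeaf_ancestor_new {a : ℕ} (ha : (F.addLeaf v l hv hl hli hw).Ancestor a F.m) :
    a = F.m ∨ F.Ancestor a v := by
  obtain ⟨_ | k, rfl⟩ := ha
  · exact Or.inl rfl
  · right
    rw [Function.iterate_succ_apply, addLeaf_parent_new]
    exact (F.addLeaf_ancestor hv hl hli hw hv).1 ⟨k, rfl⟩

theorem addLeaf_sDisjoint {s u : ℕ} (hu : u < F.m) (h : F.SDisjoint s v u) :
    (F.addLeaf v l hv hl hli hw).SDisjoint s F.m u := by
  intro a ha hau
  rw [F.addLeaf_ancestor hv hl hli hw hu] at hau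
  have ham : a < F.m := (hau.le hu).trans_lt hu
  rw [F.addLeaf_label hv hl hli hw ham]
  rcases F.addLeaf_ancestor_new hv hl hli hw ha with rfl | ha
  · exact absurd ham (lt_irrefl _)
  · exact h a ha hau

theorem addLeaf_reserve {u : ℕ} (hu : u < F.m) :
    (F.addLeaf v l hv hl hli hw).reserve u = F.reserve u := by
  simp only [reserve, F.addLeaf_label hv hl hli hw hu]

theorem addLeaf_honest_depth_le {D : ℕ}
    (hD : ∀ u, 0 < u → u < F.m → w (F.label u) = some false → F.depth u ≤ D) :
    ∀ u, 0 < u → u < (F.addLeaf v l hv hl hli hw).m →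
      w ((F.addLeaf v l hv hl hli hw).label u) = some false →
      (F.addLeaf v l hv hl hli hw).depth u ≤ D := by
  intro u h0 hu hwu
  rcases Nat.lt_succ_iff_lt_or_eq.1 hu with h | rfl
  · rw [F.addLeaf_label hv hl hli hw h] at hwu
    rw [F.addLeaf_depth hv hl hli hw h]
    exact hD u h0 h hwu
  · rw [addLeaf_label_new, hw] at hwu
    simp at hwu

end AddLeaf

theorem SDisjoint.symm {F : Fork i w} {s v₁ v₂ : ℕ} (h : F.SDisjoint s v₁ v₂) :
    F.SDisjoint s v₂ v₁ := fun u h₁ h₂ => h u h₂ h₁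

/-- A tine with positive reserve can be prolonged by one adversarial vertex at the cost of exactly
one unit of reserve. -/
theorem exists_addLeaf_reserve (F : Fork i w) {v : ℕ} (hv : v < F.m) (hr : 0 < F.reserve v) :
    ∃ (l : ℕ) (hl : F.label v < l) (hli : l ≤ i) (hw : w l = some true),
      F.reserve v = (F.addLeaf v l hv hl hli hw).reserve F.m + 1 := by
  set S := (Finset.Icc 1 i).filter fun j => F.label v < j ∧ w j = some true with hS
  have hmem : ∀ j, j ∈ S ↔ j ∈ Finset.Icc 1 i ∧ F.label v < j ∧ w j = some true := fun j =>
    Finset.mem_filter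
  have hne : S.Nonempty := Finset.card_pos.1 hr
  obtain ⟨hl, hlab, hw⟩ := (hmem _).1 (S.min'_mem hne)
  refine ⟨S.min' hne, hlab, (Finset.mem_Icc.1 hl).2, hw, ?_⟩
  rw [reserve, reserve, addLeaf_label_new, ← hS, ← Finset.card_erase_add_one (S.min'_mem hne)]
  congr 2
  ext j
  rw [Finset.mem_erase, hmem, Finset.mem_filter]
  constructor
  · rintro ⟨hj, hjS⟩
    exact ⟨hjS.1, lt_of_le_of_ne (S.min'_le j ((hmem j).2 hjS)) hj.symm, hjS.2.2⟩
  · rintro ⟨hj, hlt, hwj⟩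
    exact ⟨hlt.ne', hj, hlab.trans hlt, hwj⟩

theorem exists_balanced_of_le_depth_add_reserve {s D : ℕ} (n : ℕ) :
    ∀ (F : Fork i w) (v₁ v₂ : ℕ), v₁ < F.m → v₂ < F.m → F.SDisjoint s v₁ v₂ →
      (∀ u, 0 < u → u < F.m → w (F.label u) = some false → F.depth u ≤ D) →
      D ≤ F.depth v₁ + F.reserve v₁ → D ≤ F.depth v₂ + F.reserve v₂ →
      F.reserve v₁ + F.reserve v₂ = n → ∃ F' : Fork i w, F'.Balanced s i := by
  induction n with
  | zero =>
    intro F v₁ v₂ hv₁ hv₂ hd hD h₁ h₂ hn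
    refine ⟨F, v₁, v₂, hv₁, hv₂, ?_, ?_, hd⟩ <;>
    · rintro j - - hwj u h0 hu rfl
      have := hD u h0 hu hwj
      omega
  | succ n ih =>
    intro F
    have step : ∀ v₁ v₂, v₁ < F.m → v₂ < F.m → F.SDisjoint s v₁ v₂ →
      (∀ u, 0 < u → u < F.m → w (F.label u) = some false → F.depth u ≤ D) →
      D ≤ F.depth v₁ + F.reserve v₁ → D ≤ F.depth v₂ + F.reserve v₂ →
      F.reserve v₁ + F.reserve v₂ = n + 1 → 0 < F.reserve v₁ →
      ∃ F' : Fork i w, F'.Balanced s i := by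
      intro v₁ v₂ hv₁ hv₂ hd hD h₁ h₂ hn hr
      obtain ⟨l, hl, hli, hw, hres⟩ := F.exists_addLeaf_reserve hv₁ hr
      refine ih (F.addLeaf v₁ l hv₁ hl hli hw) F.m v₂ (Nat.lt_succ_self _)
        (hv₂.trans (Nat.lt_succ_self _)) (F.addLeaf_sDisjoint hv₁ hl hli hw hv₂ hd)
        (F.addLeaf_honest_depth_le hv₁ hl hli hw hD) ?_ ?_ ?_
      · rw [addLeaf_depth_new]
        omega
      · rwa [F.addLeaf_depth hv₁ hl hli hw hv₂, F.addLeaf_reserve hv₁ hl hli hw hv₂]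
      · rw [F.addLeaf_reserve hv₁ hl hli hw hv₂]
        omega
    intro v₁ v₂ hv₁ hv₂ hd hD h₁ h₂ hn
    by_cases hr : 0 < F.reserve v₁
    · exact step v₁ v₂ hv₁ hv₂ hd hD h₁ h₂ hn hr
    · exact step v₂ v₁ hv₂ hv₁ hd.symm hD h₂ h₁ (by omega) (by omega)

theorem exists_balanced_of_reach_nonneg (F : Fork i w) {s v₁ v₂ : ℕ} (hv₁ : v₁ < F.m)
    (hv₂ : v₂ < F.m) (hd : F.SDisjoint s v₁ v₂) (h₁ : 0 ≤ F.reach v₁) (h₂ : 0 ≤ F.reach v₂) :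
    ∃ F' : Fork i w, F'.Balanced s i := by
  unfold reach at h₁ h₂
  exact exists_balanced_of_le_depth_add_reserve (D := F.maxDepth) _ F v₁ v₂ hv₁ hv₂ hd
    (fun u _ hu _ => F.depth_le_maxDepth hu) (by omega) (by omega) rfl

/-! ### The closure of a fork -/

/-- The vertices surviving in the closure: the root and the vertices with an honest descendant.
Numbers that are not vertices are included so that the predicate holds infinitely often. -/
def Kept (F : Fork i w) (v : ℕ) : Prop :=
  F.m ≤ v ∨ v = 0 ∨ ∃ u, 0 < u ∧ u < F.m ∧ w (F.label u) = some false ∧ F.Ancestor v u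

open Classical in
/-- The number of kept vertices below `v`, which is the position of `v` in the closure. -/
noncomputable def keptIndex (F : Fork i w) (v : ℕ) : ℕ := Nat.count F.Kept v

/-- The `k`-th kept vertex. -/
noncomputable def keptVertex (F : Fork i w) (k : ℕ) : ℕ := Nat.nth F.Kept k

section Closure

variable (F : Fork i w)

theorem kept_zero : F.Kept 0 := Or.inr (Or.inl rfl)

theorem Kept.parent {F : Fork i w} {v : ℕ} (h : F.Kept v) (hv : v < F.m) :
    F.Kept (F.parent v) := by
  rcases h with h | rfl | ⟨u, h0, hu, hw, ha⟩
  · omega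
  · rw [F.parent_root]
    exact F.kept_zero
  · exact Or.inr (Or.inr ⟨u, h0, hu, hw, (F.ancestor_parent v).trans ha⟩)

theorem kept_of_honest {v : ℕ} (h0 : 0 < v) (hv : v < F.m) (hw : w (F.label v) = some false) :
    F.Kept v := Or.inr (Or.inr ⟨v, h0, hv, hw, Ancestor.refl F v⟩)

theorem infinite_kept : {v | F.Kept v}.Infinite :=
  (Set.Ici_infinite F.m).mono fun _ hv => Or.inl hv

theorem kept_keptVertex (k : ℕ) : F.Kept (F.keptVertex k) :=
  Nat.nth_mem_of_infinite F.infinite_kept k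

theorem keptVertex_keptIndex {v : ℕ} (h : F.Kept v) : F.keptVertex (F.keptIndex v) = v := by
  classical exact Nat.nth_count h

theorem keptIndex_keptVertex (k : ℕ) : F.keptIndex (F.keptVertex k) = k := by
  classical exact Nat.count_nth_of_infinite F.infinite_kept k

theorem keptVertex_strictMono : StrictMono F.keptVertex := Nat.nth_strictMono F.infinite_kept

theorem keptVertex_index_m : F.keptVertex (F.keptIndex F.m) = F.m :=
  F.keptVertex_keptIndex (Or.inl le_rfl)

theorem keptIndex_zero : F.keptIndex 0 = 0 := by
  classical exact Nat.count_zero _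

theorem keptVertex_zero : F.keptVertex 0 = 0 := by
  simpa [keptIndex_zero] using F.keptVertex_keptIndex F.kept_zero

theorem keptVertex_pos {k : ℕ} (hk : 0 < k) : 0 < F.keptVertex k := by
  simpa [keptVertex_zero] using F.keptVertex_strictMono hk

theorem keptVertex_lt {k : ℕ} (hk : k < F.keptIndex F.m) : F.keptVertex k < F.m := by
  simpa [keptVertex_index_m] using F.keptVertex_strictMono hk

theorem keptIndex_lt {u v : ℕ} (hu : F.Kept u) (hv : F.Kept v) (h : u < v) :
    F.keptIndex u < F.keptIndex v := by
  rw [← F.keptVertex_strictMono.lt_iff_lt, F.keptVertex_keptIndex hu, F.keptVertex_keptIndex hv]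
  exact h

theorem keptIndex_lt_m {v : ℕ} (h : F.Kept v) (hv : v < F.m) : F.keptIndex v < F.keptIndex F.m :=
  F.keptIndex_lt h (Or.inl le_rfl) hv

theorem keptIndex_pos {v : ℕ} (h : F.Kept v) (h0 : 0 < v) : 0 < F.keptIndex v := by
  simpa [keptIndex_zero] using F.keptIndex_lt F.kept_zero h h0

theorem keptIndex_parent_keptVertex_lt {k : ℕ} (h0 : 0 < k) (hk : k < F.keptIndex F.m) :
    F.keptIndex (F.parent (F.keptVertex k)) < k := by
  have h := F.keptVertex_lt hk
  have := F.keptIndex_lt ((F.kept_keptVertex k).parent h) (F.kept_keptVertex k)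
    (F.parent_lt _ (F.keptVertex_pos h0) h)
  rwa [keptIndex_keptVertex] at this

theorem keptVertex_index_parent {k : ℕ} (hk : k < F.keptIndex F.m) :
    F.keptVertex (F.keptIndex (F.parent (F.keptVertex k))) = F.parent (F.keptVertex k) :=
  F.keptVertex_keptIndex ((F.kept_keptVertex k).parent (F.keptVertex_lt hk))

theorem depthAux_keptIndex {k : ℕ} (hk : k < F.keptIndex F.m) :
    treeDepth (fun k => F.keptIndex (F.parent (F.keptVertex k))) k = F.depth (F.keptVertex k) := by
  suffices h : ∀ f k, k ≤ f → k < F.keptIndex F.m →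
      depthAux (fun k => F.keptIndex (F.parent (F.keptVertex k))) f k
        = F.depth (F.keptVertex k) from h k k le_rfl hk
  intro f
  induction f with
  | zero =>
    intro k hkf _
    obtain rfl : k = 0 := by omega
    rw [keptVertex_zero]
    rfl
  | succ f ih =>
    intro k hkf hk
    rcases Nat.eq_zero_or_pos k with rfl | h0
    · rw [keptVertex_zero]
      rfl
    · have hlt := F.keptIndex_parent_keptVertex_lt h0 hk
      rw [depthAux, if_neg h0.ne', ih _ (by omega) (hlt.trans hk), F.keptVertex_index_parent hk,
        F.depth_eq_succ (F.keptVertex_pos h0) (F.keptVertex_lt hk)]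

/-- The closure of `F`: all vertices without honest descendants are removed. -/
noncomputable def closure : Fork i w where
  m := F.keptIndex F.m
  m_pos := F.keptIndex_pos (Or.inl le_rfl) F.m_pos
  parent k := F.keptIndex (F.parent (F.keptVertex k))
  label k := F.label (F.keptVertex k)
  parent_root := by rw [keptVertex_zero, F.parent_root, keptIndex_zero]
  parent_lt _ := F.keptIndex_parent_keptVertex_lt
  label_root := by rw [keptVertex_zero, F.label_root]
  label_valid _ h0 hk := F.label_valid _ (F.keptVertex_pos h0) (F.keptVertex_lt hk)
  label_lt k h0 hk := by
    rw [F.keptVertex_index_parent hk]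
    exact F.label_lt _ (F.keptVertex_pos h0) (F.keptVertex_lt hk)
  honest_unique j h1 hj hw := by
    obtain ⟨v, ⟨h0, hv, rfl⟩, huniq⟩ := F.honest_unique j h1 hj hw
    have hkept := F.kept_of_honest h0 hv hw
    refine ⟨F.keptIndex v, ⟨F.keptIndex_pos hkept h0, F.keptIndex_lt_m hkept hv,
      by rw [F.keptVertex_keptIndex hkept]⟩, ?_⟩
    rintro k ⟨hk0, hk, hkl⟩
    rw [← huniq _ ⟨F.keptVertex_pos hk0, F.keptVertex_lt hk, hkl⟩, keptIndex_keptVertex]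
  honest_depth_mono k₁ k₂ h₁ hk₁ h₂ hk₂ hw₁ hw₂ hlt := by
    rw [F.depthAux_keptIndex hk₁, F.depthAux_keptIndex hk₂]
    exact F.honest_depth_mono _ _ (F.keptVertex_pos h₁) (F.keptVertex_lt hk₁)
      (F.keptVertex_pos h₂) (F.keptVertex_lt hk₂) hw₁ hw₂ hlt

theorem closure_depth {k : ℕ} (hk : k < F.closure.m) :
    F.closure.depth k = F.depth (F.keptVertex k) := F.depthAux_keptIndex hk

theorem closure_closed : F.closure.Closed := by
  intro k h0 hk hleaf
  have hv0 := F.keptVertex_pos h0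
  have hv := F.keptVertex_lt hk
  rcases F.kept_keptVertex k with h | h | ⟨u, hu0, hu, hw, n, hn⟩
  · omega
  · omega
  rcases n with _ | n
  · change w (F.label (F.keptVertex k)) = some false
    rwa [← hn]
  · rw [Function.iterate_succ_apply'] at hn
    have hxu : F.Ancestor (F.parent^[n] u) u := ⟨n, rfl⟩
    have hx : F.Kept (F.parent^[n] u) := Or.inr (Or.inr ⟨u, hu0, hu, hw, hxu⟩)
    have hx0 : 0 < F.parent^[n] u := by
      rw [Nat.pos_iff_ne_zero]
      intro h
      rw [h, F.parent_root] at hn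
      omega
    refine absurd ?_ (hleaf (F.keptIndex (F.parent^[n] u)) (F.keptIndex_pos hx hx0)
      (F.keptIndex_lt_m hx ((hxu.le hu).trans_lt hu)))
    change F.keptIndex (F.parent (F.keptVertex (F.keptIndex _))) = k
    rw [F.keptVertex_keptIndex hx, hn, keptIndex_keptVertex]

theorem ancestor_of_closure_ancestor {a k : ℕ} (hk : k < F.closure.m)
    (h : F.closure.Ancestor a k) : F.Ancestor (F.keptVertex a) (F.keptVertex k) := by
  obtain ⟨n, rfl⟩ := h
  induction n with
  | zero => exact Ancestor.refl _ _
  | succ n ih =>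
    have hlt : F.closure.parent^[n] k < F.closure.m := (Ancestor.le ⟨n, rfl⟩ hk).trans_lt hk
    rw [Function.iterate_succ_apply']
    change F.Ancestor (F.keptVertex (F.keptIndex (F.parent (F.keptVertex _)))) _
    rw [F.keptVertex_index_parent hlt]
    exact (F.ancestor_parent _).trans ih

theorem closure_maxDepth_le {v : ℕ} (hvia : F.Viable i v) : F.closure.maxDepth ≤ F.depth v := by
  refine maxDepth_le _ fun k hk => ?_
  rw [F.closure_depth hk]
  have hv := F.keptVertex_lt hk
  rcases F.kept_keptVertex k with h | h | ⟨u, hu0, hu, hw, ha⟩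
  · omega
  · rw [h, depth_root]
    exact Nat.zero_le _
  · have hval := F.label_valid u hu0 hu
    exact (ha.depth_le hu).trans (hvia _ hval.1 hval.2.1 hw u hu0 hu rfl)

theorem reserve_lt_reserve_parent {v : ℕ} (h0 : 0 < v) (hv : v < F.m)
    (hw : w (F.label v) = some true) : F.reserve v < F.reserve (F.parent v) := by
  have hlab := F.label_lt v h0 hv
  have hval := F.label_valid v h0 hv
  refine Finset.card_lt_card (Finset.ssubset_iff_of_subset ?_ |>.2 ⟨F.label v, ?_, ?_⟩)
  · intro j
    simp only [Finset.mem_filter]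
    exact fun h => ⟨h.1, hlab.trans h.2.1, h.2.2⟩
  · simp [hval.1, hval.2.1, hlab, hw]
  · simp

/-- The longest prefix of a tine that survives in the closure. -/
theorem exists_kept_ancestor (v : ℕ) : v < F.m → ∃ a, F.Ancestor a v ∧ F.Kept a ∧
    F.depth v + F.reserve v ≤ F.depth a + F.reserve a := by
  induction v using Nat.strong_induction_on with
  | _ v ih =>
    intro hv
    by_cases hk : F.Kept v
    · exact ⟨v, Ancestor.refl F v, hk, le_rfl⟩
    · have h0 : 0 < v := Nat.pos_of_ne_zero fun h => hk (h ▸ F.kept_zero)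
      have hw : w (F.label v) = some true := by
        rcases hwv : w (F.label v) with _ | _ | _
        · exact absurd hwv (F.label_valid v h0 hv).2.2
        · exact absurd (F.kept_of_honest h0 hv hwv) hk
        · rfl
      have hlt := F.parent_lt v h0 hv
      obtain ⟨a, ha, hka, hle⟩ := ih _ hlt (hlt.trans hv)
      have := F.reserve_lt_reserve_parent h0 hv hw
      have := F.depth_eq_succ h0 hv
      exact ⟨a, ha.trans (F.ancestor_parent v), hka, by omega⟩

theorem closure_reach_nonneg {v a : ℕ} (hvia : F.Viable i v) (ha : F.Kept a) (ham : a < F.m)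
    (hle : F.depth v + F.reserve v ≤ F.depth a + F.reserve a) :
    0 ≤ F.closure.reach (F.keptIndex a) := by
  have hmax := F.closure_maxDepth_le hvia
  have hdepth := F.closure_depth (F.keptIndex_lt_m ha ham)
  have hres : F.closure.reserve (F.keptIndex a) = F.reserve (F.keptVertex (F.keptIndex a)) := rfl
  rw [F.keptVertex_keptIndex ha] at hdepth hres
  unfold reach
  omega

theorem closure_marginFork_nonneg {s : ℕ} (hs : 1 ≤ s) (h : F.Balanced s i) :
    0 ≤ F.closure.marginFork s := by
  obtain ⟨v₁, v₂, hv₁, hv₂, hvia₁, hvia₂, hd⟩ := h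
  obtain ⟨a₁, ha₁, hk₁, hle₁⟩ := F.exists_kept_ancestor v₁ hv₁
  obtain ⟨a₂, ha₂, hk₂, hle₂⟩ := F.exists_kept_ancestor v₂ hv₂
  have hm₁ := (ha₁.le hv₁).trans_lt hv₁
  have hm₂ := (ha₂.le hv₂).trans_lt hv₂
  have hi₁ : F.keptIndex a₁ < F.closure.m := F.keptIndex_lt_m hk₁ hm₁
  have hi₂ : F.keptIndex a₂ < F.closure.m := F.keptIndex_lt_m hk₂ hm₂
  refine (F.closure.marginFork_nonneg_iff hs).2 ⟨_, _, hi₁, hi₂, fun u h₁ h₂ => ?_,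
    F.closure_reach_nonneg hvia₁ hk₁ hm₁ hle₁, F.closure_reach_nonneg hvia₂ hk₂ hm₂ hle₂⟩
  have h₁ := F.ancestor_of_closure_ancestor hi₁ h₁
  have h₂ := F.ancestor_of_closure_ancestor hi₂ h₂
  rw [F.keptVertex_keptIndex hk₁] at h₁
  rw [F.keptVertex_keptIndex hk₂] at h₂
  exact hd _ (h₁.trans ha₁) (h₂.trans ha₂)

end Closure

theorem depthAux_pred : ∀ f k, k ≤ f → depthAux Nat.pred f k = k := by
  intro f
  induction f with
  | zero =>
    intro k hk
    obtain rfl : k = 0 := by omega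
    rfl
  | succ f ih =>
    intro k hk
    rcases Nat.eq_zero_or_pos k with rfl | h0
    · rfl
    · rw [depthAux, if_neg h0.ne', ih _ (by rw [Nat.pred_eq_sub_one]; omega)]
      exact Nat.succ_pred_eq_of_pos h0

/-- Every string admits a fork: a single path visiting all nonempty slots. -/
theorem nonempty (i : ℕ) (w : ℕ → Trit) : Nonempty (Fork i w) := by
  classical
  let p : ℕ → Prop := fun j => i < j ∨ j = 0 ∨ w j ≠ none
  have hinf : {j | p j}.Infinite := (Set.Ioi_infinite i).mono fun _ hv => Or.inl hv
  have hmono : StrictMono (Nat.nth p) := Nat.nth_strictMono hinf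
  have h0 : p 0 := Or.inr (Or.inl rfl)
  have hm : p (i + 1) := Or.inl (Nat.lt_succ_self i)
  have hzero : Nat.nth p 0 = 0 := Nat.nth_zero_of_zero h0
  have hlt : ∀ {k}, k < Nat.count p (i + 1) → Nat.nth p k < i + 1 := Nat.nth_lt_of_lt_count
  have hpos : ∀ {k}, 0 < k → 0 < Nat.nth p k := fun {k} hk => by
    have := hmono hk
    rwa [hzero] at this
  exact ⟨{
    m := Nat.count p (i + 1)
    m_pos := by
      have := Nat.count_strict_mono h0 (Nat.succ_pos i)
      rwa [Nat.count_zero] at this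
    parent := Nat.pred
    label := Nat.nth p
    parent_root := rfl
    parent_lt := fun v hv _ => Nat.pred_lt hv.ne'
    label_root := hzero
    label_valid := fun v hv hvm => by
      have h := hlt hvm
      have h' := hpos hv
      refine ⟨h', by omega, ?_⟩
      have hpv : p (Nat.nth p v) := Nat.nth_mem_of_infinite hinf v
      exact (hpv.resolve_left (by omega)).resolve_left h'.ne'
    label_lt := fun v hv _ => hmono (Nat.pred_lt hv.ne')
    honest_unique := fun j h1 hj hw => by
      have hpj : p j := Or.inr (Or.inr (by simp [hw]))
      refine ⟨Nat.count p j, ⟨?_, Nat.count_strict_mono hpj (by omega), Nat.nth_count hpj⟩, ?_⟩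
      · have := Nat.count_strict_mono h0 (show 0 < j by omega)
        rwa [Nat.count_zero] at this
      · rintro k ⟨-, -, rfl⟩
        exact (Nat.count_nth_of_infinite hinf k).symm
    honest_depth_mono := fun v₁ v₂ _ _ _ _ _ _ hlab => by
      rw [treeDepth, treeDepth, depthAux_pred _ _ le_rfl, depthAux_pred _ _ le_rfl]
      exact hmono.lt_iff_lt.1 hlab }⟩

end Fork

theorem marginStr_nonneg_iff (i : ℕ) (w : ℕ → Trit) {s : ℕ} (hs : 1 ≤ s) :
    0 ≤ MarginStr i w s ↔ ∃ F : Fork i w, F.Closed ∧ 0 ≤ F.marginFork s := by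
  have hbdd : BddAbove {z : ℤ | ∃ F : Fork i w, F.Closed ∧ z = F.marginFork s} := by
    refine ⟨i, ?_⟩
    rintro _ ⟨F, -, rfl⟩
    exact F.marginFork_le hs
  constructor
  · intro h
    obtain ⟨F₀⟩ := Fork.nonempty i w
    obtain ⟨F, hF, hz⟩ : MarginStr i w s ∈ {z : ℤ | ∃ F : Fork i w, F.Closed ∧
        z = F.marginFork s} := Int.csSup_mem ⟨_, F₀.closure, F₀.closure_closed, rfl⟩ hbdd
    rw [hz] at h
    exact ⟨F, hF, h⟩
  · rintro ⟨F, hF, h⟩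
    exact h.trans (le_csSup hbdd ⟨F, hF, rfl⟩)

/-- There exists an `s`-balanced fork `F ⊢ w` if and only if `Margin_s(w) ≥ 0`.
(Here `ℕ` of the paper is the positive integers, so `1 ≤ s ≤ i`.) -/
theorem stmt_12 (i : ℕ) (w : ℕ → Trit) (s : ℕ) (hs1 : 1 ≤ s) (hsi : s ≤ i) :
    (∃ F : Fork i w, F.Balanced s i) ↔ 0 ≤ MarginStr i w s := by
  rw [marginStr_nonneg_iff i w hs1]
  constructor
  · rintro ⟨F, hF⟩
    exact ⟨F.closure, F.closure_closed, F.closure_marginFork_nonneg hs1 hF⟩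
  · rintro ⟨F, -, hF⟩
    obtain ⟨v₁, v₂, hv₁, hv₂, hd, h₁, h₂⟩ := (F.marginFork_nonneg_iff hs1).1 hF
    exact F.exists_balanced_of_reach_nonneg hv₁ hv₂ hd h₁ h₂
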